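/- arXiv:2004.07396 — 3 statements merged into one kernel-verified Lean document; each statement's English description precedes it below -/
import Mathlib

section
/- Let 0<δ<1/2. There exist constants x>0 and C_δ>0 such that for every C¹ function h on [0,∞) with ‖h'‖_{L^{∞,2-δ}_r} < x, the function f(r)=exp((1/2)∫₀ʳ (h(s)-h̄(s))²/s ds) satisfies, for all r≥0, 0 ≤ f(r) - f̄(r) ≤ C_δ · (r/(1+r)²) · ‖h'‖²_{L^{∞,2-δ}_r}, where f̄(r)=(1/r)∫₀ʳ f(s)ds. -/
open Set MeasureTheory Real

/-- Radial average: `w̄(r) = (1/r)∫₀ʳ w(s) ds` for `r ≠ 0`, with `w̄(0) = w(0)`. -/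
noncomputable def radAvg (w : ℝ → ℝ) (r : ℝ) : ℝ :=
  if r = 0 then w 0 else (∫ s in (0:ℝ)..r, w s) / r
/-- The metric coefficient `f(r) = exp((1/2)∫₀ʳ (h(s)-h̄(s))²/s ds)` built from `h`. -/
noncomputable def metF1 (h : ℝ → ℝ) (r : ℝ) : ℝ :=
  Real.exp (2⁻¹ * ∫ s in (0:ℝ)..r, (h s - radAvg h s) ^ 2 / s)

lemma integral_one_add_rpow {a s : ℝ} (ha : a ≠ 0) (hs : 0 ≤ s) :
    ∫ t in (0:ℝ)..s, (1 + t) ^ (a - 1) = ((1 + s) ^ a - 1) / a := by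
  have hpos : ∀ t ∈ uIcc 0 s, 0 < 1 + t := fun t ht => by
    rw [uIcc_of_le hs] at ht
    linarith [ht.1]
  have hderiv : ∀ t ∈ uIcc 0 s,
      HasDerivAt (fun t : ℝ => (1 + t) ^ a / a) ((1 + t) ^ (a - 1)) t := fun t ht => by
    have h := (((hasDerivAt_id' t).const_add 1).rpow_const (p := a)
      (Or.inl (hpos t ht).ne')).div_const a
    rwa [one_mul, mul_div_right_comm, div_self ha, one_mul] at h
  rw [intervalIntegral.integral_eq_sub_of_hasDerivAt hderiv]
  · simp [sub_div]
  · refine ContinuousOn.intervalIntegrable fun t ht => ?_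
    exact (ContinuousAt.rpow_const (by fun_prop) (Or.inl (hpos t ht).ne')).continuousWithinAt

lemma intervalIntegrable_one_add_rpow (c a : ℝ) {r : ℝ} (hr : 0 ≤ r) :
    IntervalIntegrable (fun t : ℝ => c * (1 + t) ^ a) volume 0 r := by
  refine ContinuousOn.intervalIntegrable fun t ht => ?_
  rw [uIcc_of_le hr] at ht
  exact (continuousAt_const.mul (ContinuousAt.rpow_const (by fun_prop)
    (Or.inl (by linarith [ht.1])))).continuousWithinAt

lemma mul_sub_radAvg {h : ℝ → ℝ} (hh : ContDiff ℝ 1 h) {s : ℝ} (hs : 0 < s) :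
    s * (h s - radAvg h s) = ∫ t in (0:ℝ)..s, t * deriv h t := by
  have h' : Continuous (deriv h) := hh.continuous_deriv le_rfl
  rw [intervalIntegral.integral_mul_deriv_eq_deriv_mul (u' := fun _ => 1)
    (fun t _ => hasDerivAt_id' t)
    (fun t _ => (hh.differentiable one_ne_zero t).hasDerivAt)
    (by simp) (h'.intervalIntegrable _ _)]
  simp only [radAvg, hs.ne', if_false, one_mul, zero_mul]
  field_simp
  ring

section Decay

variable {δ N : ℝ} {h : ℝ → ℝ}

lemma abs_deriv_le (hN : ∀ s : ℝ, 0 ≤ s → (1 + s) ^ (2 - δ) * |deriv h s| ≤ N)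
    {s : ℝ} (hs : 0 ≤ s) : |deriv h s| ≤ N * (1 + s) ^ (δ - 2) := by
  have hp : (0:ℝ) < (1 + s) ^ (2 - δ) := rpow_pos_of_pos (by linarith) _
  have he : (1 + s) ^ (δ - 2) = ((1 + s) ^ (2 - δ))⁻¹ := by
    rw [← rpow_neg (by linarith), neg_sub]
  rw [he, ← div_eq_mul_inv, le_div_iff₀ hp, mul_comm]
  exact hN s hs

lemma abs_sub_radAvg_le_mul (hδ₂ : δ < 1) (hh : ContDiff ℝ 1 h) (hN0 : 0 ≤ N)
    (hN : ∀ s : ℝ, 0 ≤ s → (1 + s) ^ (2 - δ) * |deriv h s| ≤ N)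
    {s : ℝ} (hs : 0 ≤ s) : |h s - radAvg h s| ≤ N * s := by
  rcases hs.eq_or_lt with rfl | hs
  · simp [radAvg]
  have key : |∫ t in (0:ℝ)..s, t * deriv h t| ≤ (N * s) * |s - 0| := by
    rw [← norm_eq_abs (∫ t in (0:ℝ)..s, t * deriv h t)]
    refine intervalIntegral.norm_integral_le_of_norm_le_const fun t ht => ?_
    rw [uIoc_of_le hs.le] at ht
    have h1 : (1 + t) ^ (δ - 2) ≤ 1 :=
      rpow_le_one_of_one_le_of_nonpos (by linarith [ht.1]) (by linarith)
    have h2 := abs_deriv_le hN ht.1.le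
    have h3 : |deriv h t| ≤ N := h2.trans (mul_le_of_le_one_right hN0 h1)
    rw [norm_mul, norm_eq_abs, norm_eq_abs, abs_of_pos ht.1, mul_comm N]
    exact mul_le_mul ht.2 h3 (abs_nonneg _) hs.le
  rw [← mul_sub_radAvg hh hs, abs_mul, sub_zero, abs_of_pos hs] at key
  nlinarith

lemma abs_sub_radAvg_le_rpow_div (hδ₁ : 0 < δ) (hh : ContDiff ℝ 1 h) (hN0 : 0 ≤ N)
    (hN : ∀ s : ℝ, 0 ≤ s → (1 + s) ^ (2 - δ) * |deriv h s| ≤ N)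
    {s : ℝ} (hs : 0 < s) : |h s - radAvg h s| ≤ N * (1 + s) ^ δ / (δ * s) := by
  have key : |∫ t in (0:ℝ)..s, t * deriv h t| ≤ ∫ t in (0:ℝ)..s, N * (1 + t) ^ (δ - 1) := by
    rw [← norm_eq_abs]
    refine intervalIntegral.norm_integral_le_of_norm_le hs.le (ae_of_all _ fun t ht => ?_)
      (intervalIntegrable_one_add_rpow _ _ hs.le)
    have hp : 0 < 1 + t := by linarith [ht.1]
    have h2 := abs_deriv_le hN ht.1.le
    have he : (1 + t) ^ (δ - 1) = (1 + t) * (1 + t) ^ (δ - 2) := by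
      nth_rewrite 2 [← rpow_one (1 + t)]
      rw [← rpow_add hp]
      congr 1
      ring
    have h3 : 0 ≤ N * (1 + t) ^ (δ - 2) := mul_nonneg hN0 (rpow_nonneg hp.le _)
    rw [norm_mul, norm_eq_abs, norm_eq_abs, abs_of_pos ht.1, he]
    nlinarith [mul_le_mul_of_nonneg_left h2 ht.1.le]
  rw [intervalIntegral.integral_const_mul, integral_one_add_rpow hδ₁.ne' hs.le,
    ← mul_sub_radAvg hh hs, abs_mul, abs_of_pos hs] at key
  have h4 : N * (((1 + s) ^ δ - 1) / δ) ≤ N * ((1 + s) ^ δ / δ) := by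
    gcongr
    linarith
  rw [le_div_iff₀ (by positivity)]
  have h5 : N * ((1 + s) ^ δ / δ) * δ = N * (1 + s) ^ δ := by field_simp
  nlinarith [mul_le_mul_of_nonneg_right (key.trans h4) hδ₁.le]

lemma abs_sub_radAvg_le (hδ₁ : 0 < δ) (hδ₂ : δ < 1) (hh : ContDiff ℝ 1 h) (hN0 : 0 ≤ N)
    (hN : ∀ s : ℝ, 0 ≤ s → (1 + s) ^ (2 - δ) * |deriv h s| ≤ N)
    {s : ℝ} (hs : 0 ≤ s) :
    |h s - radAvg h s| ≤ 4 / δ * N * (s * (1 + s) ^ (δ - 2)) := by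
  have hp : 0 < 1 + s := by linarith
  have hE : 0 < (1 + s) ^ δ := rpow_pos_of_pos hp _
  have hE1 : 1 ≤ (1 + s) ^ δ := one_le_rpow (by linarith) hδ₁.le
  have he : (1 + s) ^ (δ - 2) = (1 + s) ^ δ / (1 + s) ^ 2 := by
    rw [rpow_sub hp, rpow_two]
  rw [he]
  rcases le_total s 1 with h1 | h1
  · refine (abs_sub_radAvg_le_mul hδ₂ hh hN0 hN hs).trans ?_
    have h2 : 1 ≤ 4 / δ * ((1 + s) ^ δ / (1 + s) ^ 2) := by
      rw [div_mul_div_comm, le_div_iff₀ (by positivity)]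
      nlinarith
    nlinarith [mul_le_mul_of_nonneg_left h2 (mul_nonneg hN0 hs)]
  · have hs' : 0 < s := by linarith
    refine (abs_sub_radAvg_le_rpow_div hδ₁ hh hN0 hN hs').trans ?_
    have h2 : 4 / δ * N * (s * ((1 + s) ^ δ / (1 + s) ^ 2))
        = N * (1 + s) ^ δ * (4 * s) / (δ * (1 + s) ^ 2) := by field_simp
    rw [h2, div_le_div_iff₀ (by positivity) (by positivity)]
    have h3 : (1 + s) ^ 2 ≤ 4 * s ^ 2 := by nlinarith
    have h4 : 0 ≤ N * (1 + s) ^ δ * δ := by positivity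
    nlinarith [mul_le_mul_of_nonneg_left h3 h4]

lemma sq_sub_radAvg_le (hδ₁ : 0 < δ) (hδ₂ : δ < 1) (hh : ContDiff ℝ 1 h) (hN0 : 0 ≤ N)
    (hN : ∀ s : ℝ, 0 ≤ s → (1 + s) ^ (2 - δ) * |deriv h s| ≤ N)
    {s : ℝ} (hs : 0 ≤ s) :
    (h s - radAvg h s) ^ 2 ≤ (4 / δ * N) ^ 2 * (1 + s) ^ (2 * δ - 1 - 1) ∧
    (h s - radAvg h s) ^ 2 / s ≤ (4 / δ * N) ^ 2 * (1 + s) ^ (2 * δ - 1 - 1) := by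
  have hp : 0 < 1 + s := by linarith
  have hE : (1 + s) ^ (2 * δ - 1 - 1) = ((1 + s) ^ (δ - 2)) ^ 2 * (1 + s) ^ 2 := by
    rw [← rpow_natCast, ← rpow_mul hp.le, ← rpow_two, ← rpow_add hp]
    congr 1
    push_cast
    ring
  have h1 := pow_le_pow_left₀ (abs_nonneg _) (abs_sub_radAvg_le hδ₁ hδ₂ hh hN0 hN hs) 2
  rw [sq_abs, mul_pow, mul_pow s] at h1
  rw [hE]
  set E := ((1 + s) ^ (δ - 2)) ^ 2
  set K := (4 / δ * N) ^ 2
  have hK : 0 ≤ K * E := by positivity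
  constructor
  · refine h1.trans ?_
    nlinarith
  · rcases hs.eq_or_lt with rfl | hs
    · simpa using hK
    rw [div_le_iff₀ hs]
    refine h1.trans ?_
    have h2 : s ^ 2 ≤ (1 + s) ^ 2 * s := by nlinarith [mul_pos hs hs, mul_pos (mul_pos hs hs) hs]
    nlinarith [mul_le_mul_of_nonneg_left h2 hK]

lemma integral_le_of_le_one_add_rpow (hδ₂ : δ < 1 / 2) {g : ℝ → ℝ} {c r : ℝ} (hc : 0 ≤ c)
    (hr : 0 ≤ r) (hg : IntervalIntegrable g volume 0 r)
    (hle : ∀ s : ℝ, 0 ≤ s → g s ≤ c * (1 + s) ^ (2 * δ - 1 - 1)) :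
    ∫ s in (0:ℝ)..r, g s ≤ c / (1 - 2 * δ) := by
  refine (intervalIntegral.integral_mono_on hr hg (intervalIntegrable_one_add_rpow _ _ hr)
    fun s hs => hle s hs.1).trans ?_
  rw [intervalIntegral.integral_const_mul, integral_one_add_rpow (by linarith) hr, div_eq_mul_inv c]
  refine mul_le_mul_of_nonneg_left ?_ hc
  have h1 : ((1 + r) ^ (2 * δ - 1) - 1) / (2 * δ - 1) =
      (1 - (1 + r) ^ (2 * δ - 1)) / (1 - 2 * δ) := by
    rw [← neg_div_neg_eq]
    congr 1 <;> ring
  rw [h1, ← one_div]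
  have h2 : 0 ≤ (1 + r) ^ (2 * δ - 1) := rpow_nonneg (by linarith) _
  have h3 : 0 < 1 - 2 * δ := by linarith
  gcongr
  linarith

lemma continuousOn_sq_sub_radAvg_div (hδ₂ : δ < 1) (hh : ContDiff ℝ 1 h) (hN0 : 0 ≤ N)
    (hN : ∀ s : ℝ, 0 ≤ s → (1 + s) ^ (2 - δ) * |deriv h s| ≤ N) :
    ContinuousOn (fun s => (h s - radAvg h s) ^ 2 / s) (Ici 0) := by
  intro s hs
  rcases (show (0:ℝ) ≤ s from hs).eq_or_lt with rfl | hs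
  · have hlim : Filter.Tendsto (fun s : ℝ => N ^ 2 * s) (nhdsWithin 0 (Ici 0)) (nhds 0) := by
      have : Continuous (fun s : ℝ => N ^ 2 * s) := by fun_prop
      simpa using this.continuousWithinAt (s := Ici 0) (x := 0) |>.tendsto
    have := squeeze_zero' (f := fun s => (h s - radAvg h s) ^ 2 / s) (g := fun s => N ^ 2 * s)
      (t₀ := nhdsWithin 0 (Ici 0)) ?_ ?_ hlim
    · simpa [ContinuousWithinAt] using this
    · filter_upwards [self_mem_nhdsWithin] with s hs
      exact div_nonneg (sq_nonneg _) hs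
    · filter_upwards [self_mem_nhdsWithin] with s hs
      rcases (show (0:ℝ) ≤ s from hs).eq_or_lt with rfl | hs
      · simp
      have h1 := pow_le_pow_left₀ (abs_nonneg _) (abs_sub_radAvg_le_mul hδ₂ hh hN0 hN hs.le) 2
      rw [sq_abs] at h1
      rw [div_le_iff₀ hs]
      linarith
  · refine ContinuousAt.continuousWithinAt ?_
    have hprim : Continuous fun s => ∫ t in (0:ℝ)..s, h t :=
      intervalIntegral.continuous_primitive (fun a b => hh.continuous.intervalIntegrable a b) 0
    have hrad : ContinuousAt (radAvg h) s := by
      refine (hprim.continuousAt.div continuousAt_id hs.ne').congr ?_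
      filter_upwards [lt_mem_nhds hs] with t ht
      simp [radAvg, ht.ne']
    exact ((hh.continuous.continuousAt.sub hrad).pow 2).div continuousAt_id hs.ne'

end Decay

/-- For `φ = exp (½ ∫₀ G)` with `G` continuous, `φ - φ̄` is the average of `s ↦ s φ(s) G(s) / 2`. -/
lemma mul_exp_integral_sub {G : ℝ → ℝ} (hG : Continuous G) (r : ℝ) :
    r * exp (2⁻¹ * ∫ t in (0:ℝ)..r, G t) - ∫ s in (0:ℝ)..r, exp (2⁻¹ * ∫ t in (0:ℝ)..s, G t) =
      ∫ s in (0:ℝ)..r, s * (exp (2⁻¹ * ∫ t in (0:ℝ)..s, G t) * (2⁻¹ * G s)) := by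
  have hd : ∀ s, HasDerivAt (fun s => exp (2⁻¹ * ∫ t in (0:ℝ)..s, G t))
      (exp (2⁻¹ * ∫ t in (0:ℝ)..s, G t) * (2⁻¹ * G s)) s := fun s =>
    ((hG.integral_hasStrictDerivAt 0 s).hasDerivAt.const_mul _).exp
  have hc : Continuous fun s => exp (2⁻¹ * ∫ t in (0:ℝ)..s, G t) :=
    continuous_iff_continuousAt.2 fun s => (hd s).continuousAt
  rw [intervalIntegral.integral_mul_deriv_eq_deriv_mul (u' := fun _ => 1)
    (fun t _ => hasDerivAt_id' t) (fun t _ => hd t) (by simp)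
    ((hc.mul (continuous_const.mul hG)).intervalIntegrable _ _)]
  simp

lemma metF1_sub_radAvg {h : ℝ → ℝ}
    (hcont : ContinuousOn (fun s => (h s - radAvg h s) ^ 2 / s) (Ici 0)) {r : ℝ} (hr : 0 < r) :
    metF1 h r - radAvg (metF1 h) r =
      (∫ s in (0:ℝ)..r, metF1 h s * (2⁻¹ * (h s - radAvg h s) ^ 2)) / r := by
  set G : ℝ → ℝ := fun s => (h (max s 0) - radAvg h (max s 0)) ^ 2 / max s 0 with hGdef
  have hG : Continuous G := by
    have := hcont.comp_continuous (f := fun s : ℝ => max s 0) (by fun_prop)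
      (fun s => le_max_right s 0)
    exact this
  have hF : ∀ s, 0 ≤ s → metF1 h s = exp (2⁻¹ * ∫ t in (0:ℝ)..s, G t) := fun s hs => by
    rw [metF1]
    congr 2
    refine intervalIntegral.integral_congr fun t ht => ?_
    rw [uIcc_of_le hs] at ht
    simp [hGdef, max_eq_left ht.1]
  have h1 : ∫ s in (0:ℝ)..r, metF1 h s = ∫ s in (0:ℝ)..r, exp (2⁻¹ * ∫ t in (0:ℝ)..s, G t) := by
    refine intervalIntegral.integral_congr fun s hs => ?_
    rw [uIcc_of_le hr.le] at hs
    exact hF s hs.1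
  have h2 : ∫ s in (0:ℝ)..r, metF1 h s * (2⁻¹ * (h s - radAvg h s) ^ 2) =
      ∫ s in (0:ℝ)..r, s * (exp (2⁻¹ * ∫ t in (0:ℝ)..s, G t) * (2⁻¹ * G s)) := by
    refine intervalIntegral.integral_congr fun s hs => ?_
    rw [uIcc_of_le hr.le] at hs
    simp only [← hF s hs.1]
    rw [hGdef]
    simp only [max_eq_left hs.1]
    rcases hs.1.eq_or_lt with rfl | hs
    · simp [radAvg]
    · field_simp
  rw [h2, ← mul_exp_integral_sub hG r, ← hF r hr.le, ← h1, radAvg, if_neg hr.ne']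
  field_simp

theorem f_minus_avg_bounds (δ : ℝ) (hδ₁ : 0 < δ) (hδ₂ : δ < 1/2) :
    ∃ x > (0:ℝ), ∃ C > (0:ℝ), ∀ h : ℝ → ℝ, ContDiff ℝ 1 h →
      ∀ N : ℝ, 0 ≤ N → N < x →
      (∀ s : ℝ, 0 ≤ s → (1 + s) ^ (2 - δ) * |deriv h s| ≤ N) →
      ∀ r : ℝ, 0 ≤ r →
        0 ≤ metF1 h r - radAvg (metF1 h) r ∧
        metF1 h r - radAvg (metF1 h) r ≤ C * (r / (1 + r) ^ 2) * N ^ 2 := by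
  have hδ3 : 0 < 1 - 2 * δ := by linarith
  have hδ4 : δ < 1 := by linarith
  set M : ℝ := (4 / δ) ^ 2 / (1 - 2 * δ) with hM
  have hM0 : 0 < M := by positivity
  refine ⟨1, one_pos, 4 * exp M * (M + 1), by positivity, fun h hh N hN0 hN1 hN r hr => ?_⟩
  rcases hr.eq_or_lt with rfl | hr
  · simp [radAvg]
  have hcont := continuousOn_sq_sub_radAvg_div hδ4 hh hN0 hN
  have hgint : ∀ s, 0 ≤ s →
      IntervalIntegrable (fun s => (h s - radAvg h s) ^ 2 / s) volume 0 s := fun s hs =>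
    (hcont.mono (by rw [uIcc_of_le hs]; exact Icc_subset_Ici_self)).intervalIntegrable
  have hf : ∀ s, 0 ≤ s → metF1 h s ≤ exp M := fun s hs => by
    have h1 := integral_le_of_le_one_add_rpow hδ₂ (sq_nonneg (4 / δ * N)) hs (hgint s hs)
      fun t ht => (sq_sub_radAvg_le hδ₁ hδ4 hh hN0 hN ht).2
    have h2 : (4 / δ * N) ^ 2 / (1 - 2 * δ) = M * N ^ 2 := by rw [hM]; ring
    have h3 : N ^ 2 ≤ 1 := by nlinarith
    refine exp_le_exp.2 ?_
    nlinarith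
  rw [metF1_sub_radAvg hcont hr]
  have hA : ContinuousOn (fun s => (h s - radAvg h s) ^ 2) (Icc 0 r) := by
    refine ((continuousOn_id.mul hcont).mono Icc_subset_Ici_self).congr fun s hs => ?_
    rcases hs.1.eq_or_lt with rfl | hs
    · simp [radAvg]
    · simp only [Pi.mul_apply, id]
      field_simp
  have hAint : IntervalIntegrable (fun s => (h s - radAvg h s) ^ 2) volume 0 r :=
    ContinuousOn.intervalIntegrable (by rwa [uIcc_of_le hr.le])
  have hfc : ContinuousOn (metF1 h) (Icc 0 r) := by
    have := intervalIntegral.continuousOn_primitive_interval'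
      (hgint r hr.le) (left_mem_uIcc)
    rw [uIcc_of_le hr.le] at this
    exact (continuousOn_const.mul this).rexp
  have hfAint : IntervalIntegrable (fun s => metF1 h s * (2⁻¹ * (h s - radAvg h s) ^ 2))
      volume 0 r :=
    ContinuousOn.intervalIntegrable
      (by rw [uIcc_of_le hr.le]; exact hfc.mul (continuousOn_const.mul hA))
  constructor
  · refine div_nonneg (intervalIntegral.integral_nonneg hr.le fun s _ => ?_) hr.le
    exact mul_nonneg (exp_pos _).le (by positivity)
  have hup : ∫ s in (0:ℝ)..r, metF1 h s * (2⁻¹ * (h s - radAvg h s) ^ 2) ≤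
      exp M * ∫ s in (0:ℝ)..r, (h s - radAvg h s) ^ 2 := by
    rw [← intervalIntegral.integral_const_mul]
    refine intervalIntegral.integral_mono_on hr.le hfAint (hAint.const_mul _) fun s hs => ?_
    have h1 := sq_nonneg (h s - radAvg h s)
    exact mul_le_mul (hf s hs.1) (by linarith) (by positivity) (exp_pos _).le
  have hI : ∫ s in (0:ℝ)..r, (h s - radAvg h s) ^ 2 ≤
      4 * (M + 1) * (r ^ 2 / (1 + r) ^ 2) * N ^ 2 := by
    rcases le_total r 1 with h1 | h1
    · have h2 : ∫ s in (0:ℝ)..r, (h s - radAvg h s) ^ 2 ≤ ∫ _ in (0:ℝ)..r, N ^ 2 * r ^ 2 := by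
        refine intervalIntegral.integral_mono_on hr.le hAint (by simp) fun s hs => ?_
        rw [← mul_pow, ← sq_abs]
        refine pow_le_pow_left₀ (abs_nonneg _) ?_ 2
        exact (abs_sub_radAvg_le_mul hδ4 hh hN0 hN hs.1).trans
          (mul_le_mul_of_nonneg_left hs.2 hN0)
      rw [intervalIntegral.integral_const, sub_zero, smul_eq_mul] at h2
      have h3 : r ^ 2 / 4 ≤ r ^ 2 / (1 + r) ^ 2 := by
        gcongr
        nlinarith
      have h4 : r * (N ^ 2 * r ^ 2) ≤ N ^ 2 * r ^ 2 := mul_le_of_le_one_left (by positivity) h1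
      have h5 : r ^ 2 ≤ 4 * (M + 1) * (r ^ 2 / (1 + r) ^ 2) := by
        have : 0 ≤ M * (r ^ 2 / (1 + r) ^ 2) := by positivity
        nlinarith
      nlinarith [mul_le_mul_of_nonneg_left h5 (sq_nonneg N)]
    · have h2 := integral_le_of_le_one_add_rpow hδ₂ (sq_nonneg (4 / δ * N)) hr.le hAint
        fun t ht => (sq_sub_radAvg_le hδ₁ hδ4 hh hN0 hN ht).1
      have h3 : (4 / δ * N) ^ 2 / (1 - 2 * δ) = M * N ^ 2 := by rw [hM]; ring
      have h4 : 1 / 4 ≤ r ^ 2 / (1 + r) ^ 2 := by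
        rw [div_le_div_iff₀ (by norm_num) (by positivity)]
        nlinarith
      have h5 : M ≤ 4 * (M + 1) * (r ^ 2 / (1 + r) ^ 2) := by nlinarith
      nlinarith [mul_le_mul_of_nonneg_left h5 (sq_nonneg N)]
  rw [div_le_iff₀ hr]
  refine hup.trans ((mul_le_mul_of_nonneg_left hI (exp_pos M).le).trans_eq ?_)
  ring
end

section
/- Commuted wave equation: let U>0 and let h be a C² function on [0,U]×[0,∞) satisfying Dh = G[h](h - h̄). Then for all (u,r) with r>0: ∂_r h̄(u,r) = (h(u,r)-h̄(u,r))/r, and ∂_r h satisfies the transport equation (D - 2G[h]) ∂_r h = -J[h] · ∂_r h̄, where J[h] = G[h] - r ∂_r G[h] = 3G[h] + 3 r f[h] - ((1-3r²)/2) ∂_r f[h]. -/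
open Set MeasureTheory Real Filter

/-- Metric coefficient `f[h](u,r) = exp((1/2)∫₀ʳ (h(u,s)-h̄(u,s))²/s ds)`. -/
noncomputable def metF (h : ℝ → ℝ → ℝ) (u r : ℝ) : ℝ :=
  Real.exp (2⁻¹ * ∫ s in (0:ℝ)..r, (h u s - radAvg (h u) s) ^ 2 / s)

/-- Metric coefficient `f̃[h](u,r) = (1/r)∫₀ʳ (1-3s²) f[h](u,s) ds` (with value `1` at `r=0`). -/
noncomputable def metFt (h : ℝ → ℝ → ℝ) (u r : ℝ) : ℝ :=
  if r = 0 then 1 else (∫ s in (0:ℝ)..r, (1 - 3 * s ^ 2) * metF h u s) / r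

/-- Coefficient `G[h](u,r) = (1/(2r))[(f-f̃)(u,r) - 3 f(u,r) r²]` (with value `0` at `r=0`). -/
noncomputable def coefG (h : ℝ → ℝ → ℝ) (u r : ℝ) : ℝ :=
  if r = 0 then 0 else ((metF h u r - metFt h u r) - 3 * metF h u r * r ^ 2) / (2 * r)

/-- Coefficient `J[h] = 3G[h] + 3 r f[h] - ((1-3r²)/2) ∂_r f[h]`. -/
noncomputable def coefJ (h : ℝ → ℝ → ℝ) (u r : ℝ) : ℝ :=
  3 * coefG h u r + 3 * r * metF h u r - ((1 - 3 * r ^ 2) / 2) * deriv (fun s => metF h u s) r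

theorem hasDerivAt_integral_of_continuous {w : ℝ → ℝ} (hw : Continuous w) (a r : ℝ) :
    HasDerivAt (fun x => ∫ s in a..x, w s) (w r) r :=
  intervalIntegral.integral_hasDerivAt_right (hw.intervalIntegrable _ _)
    hw.stronglyMeasurable.stronglyMeasurableAtFilter hw.continuousAt

theorem hasDerivAt_integral_div {w : ℝ → ℝ} (hw : Continuous w) {r : ℝ} (hr : r ≠ 0) :
    HasDerivAt (fun x => (∫ s in (0:ℝ)..x, w s) / x)
      ((w r - (∫ s in (0:ℝ)..r, w s) / r) / r) r := by
  refine ((hasDerivAt_integral_of_continuous hw 0 r).div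
    (hasDerivAt_id r) hr).congr_deriv ?_
  simp only [id]
  field_simp

theorem radAvg_eq_dslope {w : ℝ → ℝ} (hw : Continuous w) :
    radAvg w = dslope (fun x => ∫ s in (0:ℝ)..x, w s) 0 := by
  ext r
  by_cases hr : r = 0
  · subst hr
    simp [radAvg, (hasDerivAt_integral_of_continuous hw 0 0).deriv]
  · simp [radAvg, hr, dslope_of_ne, slope_def_field]

theorem continuous_radAvg {w : ℝ → ℝ} (hw : Continuous w) : Continuous (radAvg w) := by
  have hd := hasDerivAt_integral_of_continuous hw 0
  rw [radAvg_eq_dslope hw, ← continuousOn_univ, continuousOn_dslope Filter.univ_mem]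
  exact ⟨fun x _ => (hd x).continuousAt.continuousWithinAt, (hd 0).differentiableAt⟩

theorem hasDerivAt_radAvg {w : ℝ → ℝ} (hw : Continuous w) {r : ℝ} (hr : r ≠ 0) :
    HasDerivAt (radAvg w) ((w r - radAvg w r) / r) r := by
  have key := hasDerivAt_integral_div hw hr
  have hval : radAvg w r = (∫ s in (0:ℝ)..r, w s) / r := if_neg hr
  rw [hval]
  refine key.congr_of_eventuallyEq ?_
  filter_upwards [isOpen_ne.mem_nhds hr] with x hx
  exact if_neg hx

/-- If `w` is differentiable at the origin, then `w - w̄ = O(r)` near `r = 0`. -/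
theorem exists_eventually_abs_sub_radAvg_le {w : ℝ → ℝ} (hw : Continuous w)
    (hw' : DifferentiableAt ℝ w 0) :
    ∃ C : ℝ, ∀ᶠ r in nhds (0:ℝ), |w r - radAvg w r| ≤ C * |r| := by
  obtain ⟨C, hC⟩ := hw'.isBigO_sub.bound
  obtain ⟨ε, hε, hball⟩ := Metric.eventually_nhds_iff.1 hC
  simp only [Real.dist_eq, Real.norm_eq_abs, sub_zero] at hball
  refine ⟨2 * C, Metric.eventually_nhds_iff.2 ⟨ε, hε, fun r hrε => ?_⟩⟩
  rw [Real.dist_eq, sub_zero] at hrε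
  by_cases hr : r = 0
  · simp [hr, radAvg]
  have hr' : 0 < |r| := abs_pos.2 hr
  have hC0 : 0 ≤ C := by
    by_contra! hneg
    nlinarith [hball hrε, abs_nonneg (w r - w 0)]
  have hI : |∫ s in (0:ℝ)..r, (w s - w 0)| ≤ C * |r| * |r| := by
    have := intervalIntegral.norm_integral_le_of_norm_le_const (a := 0) (b := r)
      (f := fun s => w s - w 0) (C := C * |r|) (fun s hs => ?_)
    · simpa using this
    · have hsr : |s| ≤ |r| := by
        simpa using Set.abs_sub_left_of_mem_uIcc (uIoc_subset_uIcc hs)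
      exact (hball (hsr.trans_lt hrε)).trans (mul_le_mul_of_nonneg_left hsr hC0)
  rw [intervalIntegral.integral_sub (hw.intervalIntegrable _ _) (by simp),
    intervalIntegral.integral_const, sub_zero, smul_eq_mul] at hI
  have havg : (∫ s in (0:ℝ)..r, w s) = r * radAvg w r := by
    rw [radAvg, if_neg hr]; field_simp
  rw [havg, ← mul_sub, abs_mul] at hI
  have h2 : |radAvg w r - w 0| ≤ C * |r| := by nlinarith
  calc |w r - radAvg w r| = |(w r - w 0) - (radAvg w r - w 0)| := by ring_nf
    _ ≤ |w r - w 0| + |radAvg w r - w 0| := abs_sub _ _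
    _ ≤ 2 * C * |r| := by linarith [hball hrε]

theorem continuous_sub_radAvg_sq_div {w : ℝ → ℝ} (hw : Continuous w)
    (hw' : DifferentiableAt ℝ w 0) :
    Continuous fun s => (w s - radAvg w s) ^ 2 / s := by
  have hd := hw.sub (continuous_radAvg hw)
  refine continuous_iff_continuousAt.2 fun r => ?_
  by_cases hr : r = 0
  · subst hr
    obtain ⟨C, hC⟩ := exists_eventually_abs_sub_radAvg_le hw hw'
    rw [ContinuousAt, div_zero]
    refine squeeze_zero_norm' (a := fun s => C ^ 2 * |s|) ?_ ?_
    · filter_upwards [hC] with s hs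
      by_cases h0 : s = 0
      · simp [h0]
      have hs0 : 0 < |s| := abs_pos.2 h0
      rw [Real.norm_eq_abs, abs_div, abs_pow, div_le_iff₀ hs0]
      calc |w s - radAvg w s| ^ 2 ≤ (C * |s|) ^ 2 := by gcongr
        _ = C ^ 2 * |s| * |s| := by ring
    · have : Continuous fun s : ℝ => C ^ 2 * |s| := by fun_prop
      simpa using this.tendsto 0
  · exact (hd.pow 2).continuousAt.div continuousAt_id hr

section Metric

variable {h : ℝ → ℝ → ℝ} {u r : ℝ}

theorem hasDerivAt_metF (hw : Continuous (h u)) (hw' : DifferentiableAt ℝ (h u) 0) (r : ℝ) :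
    HasDerivAt (fun s => metF h u s)
      (metF h u r * (2⁻¹ * ((h u r - radAvg (h u) r) ^ 2 / r))) r :=
  ((hasDerivAt_integral_of_continuous
    (continuous_sub_radAvg_sq_div hw hw') 0 r).const_mul 2⁻¹).exp

theorem continuous_metF (hw : Continuous (h u)) (hw' : DifferentiableAt ℝ (h u) 0) :
    Continuous fun s => metF h u s :=
  continuous_iff_continuousAt.2 fun r => (hasDerivAt_metF hw hw' r).continuousAt

theorem hasDerivAt_metFt (hf : Continuous fun s => metF h u s) (hr : r ≠ 0) :
    HasDerivAt (fun s => metFt h u s) (2 * coefG h u r) r := by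
  have hc : Continuous fun s => (1 - 3 * s ^ 2) * metF h u s := by fun_prop
  have key := hasDerivAt_integral_div hc hr
  have hval : metFt h u r = (∫ s in (0:ℝ)..r, (1 - 3 * s ^ 2) * metF h u s) / r := if_neg hr
  rw [← hval] at key
  have hG : 2 * coefG h u r = ((1 - 3 * r ^ 2) * metF h u r - metFt h u r) / r := by
    rw [coefG, if_neg hr]
    field_simp
    ring
  rw [hG]
  refine key.congr_of_eventuallyEq ?_
  filter_upwards [isOpen_ne.mem_nhds hr] with x hx
  exact if_neg hx

/-- The `r`-derivative of `G[h]` is `(G[h] - J[h]) / r`. -/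
theorem hasDerivAt_coefG (hw : Continuous (h u)) (hw' : DifferentiableAt ℝ (h u) 0)
    (hr : r ≠ 0) :
    HasDerivAt (fun s => coefG h u s) ((coefG h u r - coefJ h u r) / r) r := by
  have hF := (hasDerivAt_metF hw hw' r).differentiableAt.hasDerivAt
  have hFt := hasDerivAt_metFt (continuous_metF hw hw') hr
  have key := ((hF.sub hFt).sub ((hF.const_mul 3).mul (hasDerivAt_pow 2 r))).div
    ((hasDerivAt_id r).const_mul 2) (mul_ne_zero two_ne_zero hr)
  refine (key.congr_of_eventuallyEq ?_).congr_deriv ?_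
  · filter_upwards [isOpen_ne.mem_nhds hr] with x hx
    simp [coefG, hx]
  · simp only [coefJ, coefG, if_neg hr, Pi.sub_apply, Pi.mul_apply, id]
    field_simp
    ring

end Metric

section MixedPartials

variable {h : ℝ → ℝ → ℝ}

theorem hasDerivAt_snd_of_uncurry (hd : Differentiable ℝ (Function.uncurry h)) (u r : ℝ) :
    HasDerivAt (h u) (fderiv ℝ (Function.uncurry h) (u, r) (0, 1)) r :=
  (hd (u, r)).hasFDerivAt.comp_hasDerivAt r ((hasDerivAt_const r u).prodMk (hasDerivAt_id r))

theorem hasDerivAt_fst_of_uncurry (hd : Differentiable ℝ (Function.uncurry h)) (u r : ℝ) :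
    HasDerivAt (fun u' => h u' r) (fderiv ℝ (Function.uncurry h) (u, r) (1, 0)) u :=
  (hd (u, r)).hasFDerivAt.comp_hasDerivAt (f := fun u' => (u', r)) u ((hasDerivAt_id u).prodMk (hasDerivAt_const u r))

theorem differentiable_uncurry_fderiv_apply (hreg : ContDiff ℝ 2 (Function.uncurry h))
    (v : ℝ × ℝ) :
    Differentiable ℝ (Function.uncurry fun u r => fderiv ℝ (Function.uncurry h) (u, r) v) :=
  ((hreg.fderiv_right (m := 1) (by norm_num)).differentiable one_ne_zero).clm_apply
    (differentiable_const v)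

theorem fderiv_uncurry_fderiv_apply (hreg : ContDiff ℝ 2 (Function.uncurry h))
    (v p x : ℝ × ℝ) :
    fderiv ℝ (Function.uncurry fun u r => fderiv ℝ (Function.uncurry h) (u, r) v) p x =
      fderiv ℝ (fderiv ℝ (Function.uncurry h)) p x v := by
  have hd := (hreg.fderiv_right (m := 1) (by norm_num)).differentiable one_ne_zero
  have := ((hd p).hasFDerivAt.clm_apply (hasFDerivAt_const v p)).fderiv
  have e : (Function.uncurry fun u r => fderiv ℝ (Function.uncurry h) (u, r) v) =
    fun y => fderiv ℝ (Function.uncurry h) y v := rfl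
  rw [e, this]
  simp

/-- Schwarz's theorem for a `C²` function of two real variables. -/
theorem hasDerivAt_deriv_fst (hreg : ContDiff ℝ 2 (Function.uncurry h)) (u r : ℝ) :
    HasDerivAt (fun s => deriv (fun u' => h u' s) u)
      (deriv (fun u' => deriv (h u') r) u) r := by
  have hd := hreg.differentiable two_ne_zero
  have e₁ : (fun s => deriv (fun u' => h u' s) u) =
      (fun u s => fderiv ℝ (Function.uncurry h) (u, s) (1, 0)) u :=
    funext fun s => (hasDerivAt_fst_of_uncurry hd u s).deriv
  have e₂ : (fun u' => deriv (h u') r) =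
      fun u' => (fun u s => fderiv ℝ (Function.uncurry h) (u, s) (0, 1)) u' r :=
    funext fun u' => (hasDerivAt_snd_of_uncurry hd u' r).deriv
  rw [e₁, e₂, (hasDerivAt_fst_of_uncurry
    (differentiable_uncurry_fderiv_apply hreg (0, 1)) u r).deriv]
  refine (hasDerivAt_snd_of_uncurry
    (differentiable_uncurry_fderiv_apply hreg (1, 0)) u r).congr_deriv ?_
  rw [fderiv_uncurry_fderiv_apply hreg, fderiv_uncurry_fderiv_apply hreg]
  exact (hreg.contDiffAt.isSymmSndFDerivAt (by simp)) _ _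

end MixedPartials

theorem commuted_wave_equation (U : ℝ) (hU : 0 < U) (h : ℝ → ℝ → ℝ)
    (hreg : ContDiff ℝ 2 (Function.uncurry h))
    (heq : ∀ u ∈ Icc (0:ℝ) U, ∀ r : ℝ, 0 ≤ r →
      deriv (fun u' => h u' r) u - 2⁻¹ * metFt h u r * deriv (h u) r =
        coefG h u r * (h u r - radAvg (h u) r)) :
    ∀ u ∈ Icc (0:ℝ) U, ∀ r : ℝ, 0 < r →
      deriv (radAvg (h u)) r = (h u r - radAvg (h u) r) / r ∧
      deriv (fun u' => deriv (h u') r) u - 2⁻¹ * metFt h u r * deriv (deriv (h u)) r -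
          2 * coefG h u r * deriv (h u) r =
        -(coefJ h u r) * deriv (radAvg (h u)) r ∧
      coefJ h u r = coefG h u r - r * deriv (fun s => coefG h u s) r := by
  intro u hu r hr
  have hr0 : r ≠ 0 := hr.ne'
  have hu2 : ContDiff ℝ 2 (h u) := hreg.comp (contDiff_const.prodMk contDiff_id)
  have hw := hu2.continuous
  have hdw : Differentiable ℝ (h u) := hu2.differentiable two_ne_zero
  have hdw' : HasDerivAt (deriv (h u)) (deriv (deriv (h u)) r) r :=
    ((ContDiff.deriv' (n := 1) hu2).differentiable one_ne_zero r).hasDerivAt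
  have hA := hasDerivAt_radAvg hw hr0
  have hFt := hasDerivAt_metFt (continuous_metF hw (hdw 0)) hr0
  have hG := hasDerivAt_coefG hw (hdw 0) hr0
  have hlhs := (hasDerivAt_deriv_fst hreg u r).sub ((hFt.const_mul 2⁻¹).mul hdw')
  have hrhs := hG.mul ((hdw r).hasDerivAt.sub hA)
  have hderiv := hlhs.unique (hrhs.congr_of_eventuallyEq (by
    filter_upwards [Ioi_mem_nhds hr] with s hs
    exact heq u hu s (le_of_lt hs)))
  refine ⟨hA.deriv, ?_, ?_⟩
  · rw [hA.deriv]
    simp only [Pi.sub_apply] at hderiv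
    linear_combination hderiv
  · rw [hG.deriv]
    field_simp
    ring
end

section
/- Convergence of the scalar field at infinity: let 0<δ<1/2, C>0, and let h be a C¹ function on [0,∞)×[0,∞) such that ‖∂_r h(u,·)‖_{L^{∞,2-δ}_r} ≤ C e^{-(1+δ/2)u} for all u ≥ 0. Then for each u ≥ 0 the limit φ̲(u) := lim_{r→∞} h(u,r) exists, the function φ̲ is continuous on [0,∞), and there exists C'>0 such that for all u ≥ 0 and r ≥ 0 both |h(u,r) - φ̲(u)| ≤ C' (1+r)^{-(1-δ)} e^{-(1+δ/2)u} and |h̄(u,r) - φ̲(u)| ≤ C' (1+r)^{-(1-δ)} e^{-(1+δ/2)u}, where h̄(u,r)=(1/r)∫₀ʳ h(u,s)ds is the radial average (equal to the scalar field φ when h=∂_r(rφ)). -/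
open Set MeasureTheory Real Filter

/-- If `|f'| ≤ g'` on `[0, ∞)`, then increments of `f` are controlled by those of `g`. -/
theorem abs_sub_le_sub_of_abs_deriv_le {f g f' g' : ℝ → ℝ}
    (hf : ∀ x, 0 ≤ x → HasDerivAt f (f' x) x) (hg : ∀ x, 0 ≤ x → HasDerivAt g (g' x) x)
    (hfg : ∀ x, 0 ≤ x → |f' x| ≤ g' x) {r s : ℝ} (hr : 0 ≤ r) (hrs : r ≤ s) :
    |f s - f r| ≤ g s - g r := by
  have h₁ : MonotoneOn (fun x => g x - f x) (Ici 0) := by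
    refine monotoneOn_of_hasDerivWithinAt_nonneg (f' := fun x => g' x - f' x) (convex_Ici 0)
      (fun x hx => ((hg x hx).sub (hf x hx)).continuousAt.continuousWithinAt)
      (fun x hx => ((hg x ?_).sub (hf x ?_)).hasDerivWithinAt) (fun x hx => ?_)
    · exact interior_subset hx
    · exact interior_subset hx
    · exact sub_nonneg.2 ((le_abs_self _).trans (hfg x (interior_subset hx)))
  have h₂ : MonotoneOn (fun x => g x + f x) (Ici 0) := by
    refine monotoneOn_of_hasDerivWithinAt_nonneg (f' := fun x => g' x + f' x) (convex_Ici 0)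
      (fun x hx => ((hg x hx).add (hf x hx)).continuousAt.continuousWithinAt)
      (fun x hx => ((hg x ?_).add (hf x ?_)).hasDerivWithinAt) (fun x hx => ?_)
    · exact interior_subset hx
    · exact interior_subset hx
    · have := (neg_le_abs _).trans (hfg x (interior_subset hx))
      linarith
  have h₃ := h₁ (mem_Ici.2 hr) (mem_Ici.2 (hr.trans hrs)) hrs
  have h₄ := h₂ (mem_Ici.2 hr) (mem_Ici.2 (hr.trans hrs)) hrs
  simp only at h₃ h₄
  exact abs_le.2 ⟨by linarith, by linarith⟩

theorem hasDerivAt_const_mul_one_add_rpow (c p : ℝ) {x : ℝ} (hx : 0 ≤ x) :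
    HasDerivAt (fun y : ℝ => c * (1 + y) ^ p) (c * (p * (1 + x) ^ (p - 1))) x := by
  have h := (((hasDerivAt_id x).const_add 1).rpow_const (p := p)
    (Or.inl (by simp only [id]; positivity))).const_mul c
  simpa using h

theorem tendsto_const_mul_one_add_rpow_neg (c : ℝ) {a : ℝ} (ha : 0 < a) :
    Tendsto (fun r : ℝ => c * (1 + r) ^ (-a)) atTop (nhds 0) := by
  have h := ((tendsto_rpow_neg_atTop ha).comp
    (tendsto_atTop_add_const_left atTop (1 : ℝ) tendsto_id)).const_mul c
  simpa [Function.comp_def] using h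

/-- A function whose derivative is `O((1 + r)^(-(1 + a)))` converges at infinity with rate
`O((1 + r)^(-a))`. -/
theorem exists_tendsto_of_abs_deriv_le {w : ℝ → ℝ} (hw : Differentiable ℝ w) {a K : ℝ}
    (ha : 0 < a) (hK : 0 ≤ K) (hd : ∀ r, 0 ≤ r → |deriv w r| ≤ K * (1 + r) ^ (-a - 1)) :
    ∃ L, Tendsto w atTop (nhds L) ∧ ∀ r, 0 ≤ r → |w r - L| ≤ K / a * (1 + r) ^ (-a) := by
  have key : ∀ r s, 0 ≤ r → r ≤ s → |w s - w r| ≤ K / a * (1 + r) ^ (-a) := by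
    intro r s hr hrs
    have h := abs_sub_le_sub_of_abs_deriv_le (fun x _ => (hw x).hasDerivAt)
      (fun x hx => hasDerivAt_const_mul_one_add_rpow (-(K / a)) (-a) hx)
      (fun x hx => (hd x hx).trans_eq (by field_simp)) hr hrs
    have : 0 ≤ K / a * (1 + s) ^ (-a) := by
      have : 0 ≤ 1 + s := by linarith
      positivity
    linarith
  have hc : CauchySeq w := by
    refine Metric.cauchySeq_iff'.2 fun ε hε => ?_
    obtain ⟨N, hN, hN0⟩ := (((tendsto_const_mul_one_add_rpow_neg (K / a) ha).eventually
      (gt_mem_nhds hε)).and (eventually_ge_atTop 0)).exists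
    exact ⟨N, fun n hn => (key N n hN0 hn).trans_lt hN⟩
  obtain ⟨L, hL⟩ := cauchySeq_tendsto_of_complete hc
  refine ⟨L, hL, fun r hr => ?_⟩
  rw [abs_sub_comm]
  exact le_of_tendsto (hL.sub_const (w r)).abs
    ((eventually_ge_atTop r).mono fun s hs => key r s hr hs)

/-- Radial averaging preserves the decay rate `(1 + r)^(-(1 - δ))` towards a constant. -/
theorem abs_radAvg_sub_le {w : ℝ → ℝ} (hw : Continuous w) {δ B L : ℝ} (hδ : 0 < δ) (hδ₁ : δ ≤ 1)
    (hB : 0 ≤ B) (hL : ∀ r, 0 ≤ r → |w r - L| ≤ B * (1 + r) ^ (-(1 - δ))) {r : ℝ} (hr : 0 ≤ r) :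
    |radAvg w r - L| ≤ B / δ * (1 + r) ^ (-(1 - δ)) := by
  rcases hr.eq_or_lt with rfl | hr'
  · have h := hL 0 le_rfl
    have : B ≤ B / δ := le_div_self hB hδ hδ₁
    simp only [radAvg, add_zero, one_rpow, mul_one, if_true] at h ⊢
    exact h.trans this
  · have h := abs_sub_le_sub_of_abs_deriv_le (f := fun x => (∫ s in (0:ℝ)..x, w s) - L * x)
      (f' := fun x => w x - L)
      (fun x _ => by
        have hLx : HasDerivAt (fun y => L * y) L x := by
          simpa using (hasDerivAt_id x).const_mul L
        exact (hw.integral_hasStrictDerivAt 0 x).hasDerivAt.sub hLx)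
      (fun x hx => hasDerivAt_const_mul_one_add_rpow (B / δ) δ hx)
      (fun x hx => (hL x hx).trans_eq (by
        rw [neg_sub]
        field_simp)) le_rfl hr
    simp only [intervalIntegral.integral_same, mul_zero, sub_zero, add_zero, one_rpow,
      mul_one] at h
    have h₁ : radAvg w r - L = ((∫ s in (0:ℝ)..r, w s) - L * r) / r := by
      rw [radAvg, if_neg hr'.ne']
      field_simp
    have h₂ : (1 + r) ^ δ = (1 + r) ^ (-(1 - δ)) * (1 + r) := by
      rw [← rpow_add_one (by positivity)]
      congr 1
      ring
    have h₃ : (1 + r) ^ (-(1 - δ)) ≤ 1 :=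
      rpow_le_one_of_one_le_of_nonpos (by linarith) (by linarith)
    rw [h₁, abs_div, abs_of_pos hr', div_le_iff₀ hr']
    have hBδ : 0 ≤ B / δ := by positivity
    rw [h₂] at h
    nlinarith [mul_le_mul_of_nonneg_left h₃ hBδ]

theorem scalar_field_limit_at_infinity (δ C : ℝ) (hδ₁ : 0 < δ) (hδ₂ : δ < 1/2)
    (hC : 0 < C) (h : ℝ → ℝ → ℝ) (hreg : ContDiff ℝ 1 (Function.uncurry h))
    (hdec : ∀ u : ℝ, 0 ≤ u → ∀ r : ℝ, 0 ≤ r →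
      (1 + r) ^ (2 - δ) * |deriv (h u) r| ≤ C * Real.exp (-(1 + δ / 2) * u)) :
    ∃ φ : ℝ → ℝ, ContinuousOn φ (Ici 0) ∧
      (∀ u : ℝ, 0 ≤ u → Tendsto (h u) atTop (nhds (φ u))) ∧
      ∃ C' > (0:ℝ), ∀ u : ℝ, 0 ≤ u → ∀ r : ℝ, 0 ≤ r →
        |h u r - φ u| ≤ C' * (1 + r) ^ (-(1 - δ)) * Real.exp (-(1 + δ / 2) * u) ∧
        |radAvg (h u) r - φ u| ≤ C' * (1 + r) ^ (-(1 - δ)) * Real.exp (-(1 + δ / 2) * u) := by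
  have hδ' : 0 < 1 - δ := by linarith
  have hlim : ∀ u, 0 ≤ u → ∃ L, Tendsto (h u) atTop (nhds L) ∧ ∀ r, 0 ≤ r →
      |h u r - L| ≤ C * exp (-(1 + δ / 2) * u) / (1 - δ) * (1 + r) ^ (-(1 - δ)) := by
    intro u hu
    have hdiff : Differentiable ℝ (h u) :=
      (hreg.differentiable one_ne_zero).comp (differentiable_const u |>.prodMk differentiable_id)
    refine exists_tendsto_of_abs_deriv_le hdiff hδ' (by positivity) fun r hr => ?_
    have hp : (0:ℝ) < (1 + r) ^ (2 - δ) := by positivity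
    rw [show -(1 - δ) - 1 = -(2 - δ) by ring, rpow_neg (by positivity), ← div_eq_mul_inv,
      le_div_iff₀ hp, mul_comm]
    exact hdec u hu r hr
  choose! φ hφ hbound using hlim
  refine ⟨φ, ?_, hφ, C / (1 - δ) / δ, by positivity, fun u hu r hr => ⟨?_, ?_⟩⟩
  · have hunif : TendstoUniformlyOn (fun r u => h u r) φ atTop (Ici 0) := by
      refine Metric.tendstoUniformlyOn_iff.2 fun ε hε => ?_
      filter_upwards [(tendsto_const_mul_one_add_rpow_neg (C / (1 - δ)) hδ').eventually
        (gt_mem_nhds hε), eventually_ge_atTop 0] with r hr hr0 u hu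
      have hu : 0 ≤ u := hu
      rw [dist_comm, Real.dist_eq]
      refine (hbound u hu r hr0).trans_lt (lt_of_le_of_lt ?_ hr)
      have hexp : exp (-(1 + δ / 2) * u) ≤ 1 := exp_le_one_iff.2 (by nlinarith)
      gcongr
      exact mul_le_of_le_one_right hC.le hexp
    refine hunif.continuousOn (Eventually.of_forall fun r => ?_).frequently
    exact (hreg.continuous.comp (by fun_prop : Continuous fun u : ℝ => (u, r))).continuousOn
  · have h₁ : C / (1 - δ) ≤ C / (1 - δ) / δ := le_div_self (by positivity) hδ₁ (by linarith)
    calc |h u r - φ u| ≤ _ := hbound u hu r hr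
      _ = C / (1 - δ) * (1 + r) ^ (-(1 - δ)) * exp (-(1 + δ / 2) * u) := by ring
      _ ≤ _ := by gcongr
  · have hcont : Continuous (h u) :=
      hreg.continuous.comp (by fun_prop : Continuous fun r : ℝ => (u, r))
    refine (abs_radAvg_sub_le hcont hδ₁ (by linarith) (by positivity)
      (hbound u hu) hr).trans_eq ?_
    ring
end
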